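/- In the alkali atom Zeno limit, the 3×3 array of operators Ŝ_{jk} = |g⟩⟨g| ⊗ (δ_{jk} I − (γ/((3/2)γ + iΔ)) σ_j σ_k), where σ_j are the Pauli matrices, defines a unitary operator on (|g⟩ ⊗ ℂ²)³, i.e. Σ_l Ŝ_{lj}* Ŝ_{lk} = δ_{jk} on the Zeno subspace. -/

import Mathlib

open Matrix

/-- The Pauli matrices. -/
noncomputable def pauli : Fin 3 → Matrix (Fin 2) (Fin 2) ℂ :=
  ![!![0, 1; 1, 0], !![0, -Complex.I; Complex.I, 0], !![1, 0; 0, -1]]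

theorem pauli_herm_aux (j : Fin 3) : (pauli j)ᴴ = pauli j := by
  fin_cases j <;> ext a b <;> fin_cases a <;> fin_cases b <;> simp [pauli]

theorem pauli_sq_aux (j : Fin 3) : pauli j * pauli j = 1 := by
  fin_cases j <;> ext a b <;> fin_cases a <;> fin_cases b <;> simp [pauli]

theorem coeff_aux (γ Δ : ℝ) (hγ : 0 < γ) (c : ℂ)
    (hc : c = (γ : ℂ) / ((3 / 2 : ℂ) * γ + Complex.I * Δ)) :
    c + star c = 3 * (star c * c) := by
  have h1 : (3 / 2 : ℂ) * γ + Complex.I * Δ ≠ 0 := by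
    intro h
    have := congrArg Complex.re h
    norm_num at this
    exact hγ.ne' this
  have h2 : (3 / 2 : ℂ) * γ - Complex.I * Δ ≠ 0 := by
    intro h
    have := congrArg Complex.re h
    norm_num at this
    exact hγ.ne' this
  have h3 : star c = (γ : ℂ) / ((3 / 2 : ℂ) * γ - Complex.I * Δ) := by
    have h32 : (starRingEnd ℂ) (3 / 2 : ℂ) = 3 / 2 := by
      rw [map_div₀, map_ofNat, map_ofNat]
    rw [hc, Complex.star_def, map_div₀, map_add, map_mul, map_mul, h32, Complex.conj_I,
      Complex.conj_ofReal, Complex.conj_ofReal]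
    congr 1
    ring
  rw [h3, hc, div_add_div _ _ h1 h2, div_mul_div_comm, ← mul_div_assoc, mul_comm (_ - _) (_ + _)]
  congr 1
  ring

/-- The Zeno scattering matrix of the alkali atom model,
`Ŝ_{jk} = δ_{jk} I − (γ/((3/2)γ + iΔ)) σ_j σ_k`, is unitary:
`Σ_l Ŝ_{lj}* Ŝ_{lk} = δ_{jk} I`. -/
theorem alkali_zeno_scattering_unitary (γ Δ : ℝ) (hγ : 0 < γ) :
    let S : Fin 3 → Fin 3 → Matrix (Fin 2) (Fin 2) ℂ := fun j k =>
      (if j = k then 1 else 0) -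
        ((γ : ℂ) / ((3 / 2 : ℂ) * γ + Complex.I * Δ)) • (pauli j * pauli k)
    ∀ j k : Fin 3,
      (∑ l : Fin 3, (S l j)ᴴ * (S l k)) =
        if j = k then (1 : Matrix (Fin 2) (Fin 2) ℂ) else 0 := by
  intro S j k
  obtain ⟨c, hc⟩ : ∃ c : ℂ, c = (γ : ℂ) / ((3 / 2 : ℂ) * γ + Complex.I * Δ) := ⟨_, rfl⟩
  have hcc := coeff_aux γ Δ hγ c hc
  have hS : ∀ l k, S l k = (if l = k then 1 else 0) - c • (pauli l * pauli k) := by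
    intro l k
    rw [hc]
  have hterm : ∀ l, (S l j)ᴴ * S l k =
      (if l = j then (if l = k then 1 else 0) else 0)
        - (if l = j then c • (pauli j * pauli k) else 0)
        - (if l = k then star c • (pauli j * pauli k) else 0)
        + (star c * c) • (pauli j * pauli k) := by
    intro l
    have h4 : pauli j * pauli l * (pauli l * pauli k) = pauli j * pauli k := by
      rw [mul_assoc, ← mul_assoc (pauli l), pauli_sq_aux, one_mul]
    have h5 : (if l = j then (1 : Matrix (Fin 2) (Fin 2) ℂ) else 0)ᴴ = if l = j then 1 else 0 := by
      split_ifs <;> simp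
    rw [hS, hS, conjTranspose_sub, conjTranspose_smul, conjTranspose_mul, pauli_herm_aux,
      pauli_herm_aux, h5, sub_mul, mul_sub, mul_sub, smul_mul_smul_comm, h4]
    by_cases hj : l = j <;> by_cases hk : l = k
    · subst hj; subst hk; simp; abel
    · subst hj; simp [hk]
    · subst hk; simp [hj]; abel
    · simp [hj, hk]
  simp only [hterm, Finset.sum_add_distrib, Finset.sum_sub_distrib, Finset.sum_ite_eq',
    Finset.mem_univ, if_true, Finset.sum_const, Finset.card_univ, Fintype.card_fin]
  have h6 : c • (pauli j * pauli k) + star c • (pauli j * pauli k)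
      = 3 • ((star c * c) • (pauli j * pauli k)) := by
    rw [← add_smul, hcc, mul_smul, ← Nat.cast_smul_eq_nsmul ℂ]
    norm_num
  rw [← h6]
  abel
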